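/- Let N ≥ 3 be an integer, μ̄ = (N−2)²/4, 0 < μ < μ̄ and σ > 0. Define W_σ(x) = C_μ · ((N−2)/2) · σ^{(N−4)/2} · (|x|^{β₂} − σ²|x|^{β₁}) / (σ²|x|^{β₁} + |x|^{β₂})^{N/2}, which is the derivative of V_σ(x) with respect to σ. Then W_σ satisfies −Δ W_σ(x) − μ W_σ(x)/|x|² = (2* − 1) · V_σ(x)^{2*−2} · W_σ(x) for every x ∈ ℝ^N \ {0}, where 2* = 2N/(N−2) and Δ is the Euclidean Laplacian (the sum over coordinate directions of the unmixed second partial derivatives). In other words, ∂V_σ/∂σ is an eigenfunction of the linearized operator −Δ − μ/|x|² with weight V_σ^{2*−2} and eigenvalue 2* − 1. -/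

import Mathlib

theorem hasFDerivAt_norm_of_ne_zero {E : Type*} [NormedAddCommGroup E] [InnerProductSpace ℝ E]
    {y : E} (hy : y ≠ 0) : HasFDerivAt (fun z : E => ‖z‖) (‖y‖⁻¹ • innerSL ℝ y) y := by
  have hn : ‖y‖ ≠ 0 := norm_ne_zero_iff.mpr hy
  have h := ((hasStrictFDerivAt_norm_sq y).hasFDerivAt).sqrt (pow_ne_zero 2 hn)
  simp only [Real.sqrt_sq (norm_nonneg _)] at h
  convert h using 1
  ext v
  simp
  field_simp

theorem fderiv_comp_norm_single {N : ℕ} {f : ℝ → ℝ} {f' : ℝ} {y : EuclideanSpace ℝ (Fin N)}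
    (hy : y ≠ 0) (hf : HasDerivAt f f' ‖y‖) (i : Fin N) :
    fderiv ℝ (fun z : EuclideanSpace ℝ (Fin N) => f ‖z‖) y (EuclideanSpace.single i (1 : ℝ)) =
      f' * (y i / ‖y‖) := by
  have h := hf.comp_hasFDerivAt y (hasFDerivAt_norm_of_ne_zero hy)
  rw [show (fun z : EuclideanSpace ℝ (Fin N) => f ‖z‖) = f ∘ fun z => ‖z‖ from rfl, h.fderiv]
  simp [EuclideanSpace.inner_single_right, div_eq_inv_mul]

/-- The Laplacian of a radial function in terms of its profile. -/
theorem sum_fderiv_fderiv_comp_norm {N : ℕ} {f f' : ℝ → ℝ} {f₂ : ℝ}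
    {x : EuclideanSpace ℝ (Fin N)} (hx : x ≠ 0) (hf : ∀ r, 0 < r → HasDerivAt f (f' r) r)
    (hf' : HasDerivAt f' f₂ ‖x‖) :
    ∑ i : Fin N, fderiv ℝ (fun y => fderiv ℝ (fun z : EuclideanSpace ℝ (Fin N) => f ‖z‖) y
        (EuclideanSpace.single i (1 : ℝ))) x (EuclideanSpace.single i (1 : ℝ)) =
      f₂ + ((N : ℝ) - 1) / ‖x‖ * f' ‖x‖ := by
  have hn : ‖x‖ ≠ 0 := norm_ne_zero_iff.mpr hx
  have hterm : ∀ i : Fin N,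
      fderiv ℝ (fun y => fderiv ℝ (fun z : EuclideanSpace ℝ (Fin N) => f ‖z‖) y
        (EuclideanSpace.single i (1 : ℝ))) x (EuclideanSpace.single i (1 : ℝ)) =
      (f₂ * ‖x‖ - f' ‖x‖) / ‖x‖ ^ 3 * (x i) ^ 2 + f' ‖x‖ / ‖x‖ := by
    intro i
    have hev : (fun y => fderiv ℝ (fun z : EuclideanSpace ℝ (Fin N) => f ‖z‖) y
        (EuclideanSpace.single i (1 : ℝ))) =ᶠ[nhds x]
        fun y => (fun r => f' r / r) ‖y‖ * y i := by
      filter_upwards [isOpen_ne.mem_nhds hx] with y hy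
      rw [fderiv_comp_norm_single hy (hf _ (norm_pos_iff.mpr hy))]
      ring
    have hg := (hf'.div (hasDerivAt_id ‖x‖) hn).comp_hasFDerivAt x (hasFDerivAt_norm_of_ne_zero hx)
    have hp := (EuclideanSpace.proj i : EuclideanSpace ℝ (Fin N) →L[ℝ] ℝ).hasFDerivAt (x := x)
    have hm := (hg.mul hp).congr_of_eventuallyEq hev
    rw [hm.fderiv]
    simp [EuclideanSpace.inner_single_right]
    field_simp
    ring
  simp_rw [hterm]
  rw [Finset.sum_add_distrib, ← Finset.mul_sum, ← EuclideanSpace.real_norm_sq_eq]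
  simp
  field_simp
  ring

section Profile

variable {m k σ A r : ℝ}

theorem hasDerivAt_rpow_euler (p : ℝ) (hr : 0 < r) :
    HasDerivAt (fun t : ℝ => t ^ p) (p * r ^ p / r) r := by
  have h := Real.hasDerivAt_rpow_const (x := r) (p := p) (Or.inl hr.ne')
  rwa [Real.rpow_sub_one hr.ne', ← mul_div_assoc] at h

theorem hasDerivAt_denominator_rpow (p : ℝ) (hσ : 0 < σ) (hr : 0 < r) :
    HasDerivAt (fun t : ℝ => (σ ^ 2 * t ^ (1 - k) + t ^ (1 + k)) ^ p)
      (p * (((1 - k) * (σ ^ 2 * r ^ (1 - k)) + (1 + k) * r ^ (1 + k)) / r) *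
        (σ ^ 2 * r ^ (1 - k) + r ^ (1 + k)) ^ (p - 1)) r := by
  have hD : 0 < σ ^ 2 * r ^ (1 - k) + r ^ (1 + k) := by positivity
  have h := (((hasDerivAt_rpow_euler (1 - k) hr).const_mul (σ ^ 2)).add
    (hasDerivAt_rpow_euler (1 + k) hr)).rpow_const (p := p) (Or.inl hD.ne')
  refine h.congr_deriv ?_
  simp only [Pi.add_apply]
  ring

/-- The first derivative of the profile of `∂V_σ/∂σ`. -/
theorem hasDerivAt_profile (hσ : 0 < σ) (hr : 0 < r) :
    HasDerivAt (fun t : ℝ => A * (t ^ (1 + k) - σ ^ 2 * t ^ (1 - k)) *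
        (σ ^ 2 * t ^ (1 - k) + t ^ (1 + k)) ^ (-(m + 1)))
      (A * (((1 + k) * r ^ (1 + k) - (1 - k) * (σ ^ 2 * r ^ (1 - k))) *
          (σ ^ 2 * r ^ (1 - k) + r ^ (1 + k)) -
        (m + 1) * (r ^ (1 + k) - σ ^ 2 * r ^ (1 - k)) *
          ((1 + k) * r ^ (1 + k) + (1 - k) * (σ ^ 2 * r ^ (1 - k)))) *
        (σ ^ 2 * r ^ (1 - k) + r ^ (1 + k)) ^ (-(m + 2)) / r) r := by
  have hD : 0 < σ ^ 2 * r ^ (1 - k) + r ^ (1 + k) := by positivity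
  have h := (((hasDerivAt_rpow_euler (1 + k) hr).sub
    ((hasDerivAt_rpow_euler (1 - k) hr).const_mul (σ ^ 2))).const_mul A).mul
    (hasDerivAt_denominator_rpow (k := k) (-(m + 1)) hσ hr)
  refine h.congr_deriv ?_
  have e₁ : (σ ^ 2 * r ^ (1 - k) + r ^ (1 + k)) ^ (-(m + 1)) =
      (σ ^ 2 * r ^ (1 - k) + r ^ (1 + k)) ^ (-(m + 2)) *
        (σ ^ 2 * r ^ (1 - k) + r ^ (1 + k)) := by
    rw [← Real.rpow_add_one hD.ne']
    ring_nf
  rw [show -(m + 1) - 1 = -(m + 2) by ring, e₁]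
  simp only [Pi.sub_apply]
  ring

/-- The second derivative of the profile of `∂V_σ/∂σ`, in the form given by the linearized
equation. -/
theorem hasDerivAt_deriv_profile (hσ : 0 < σ) (hr : 0 < r) :
    HasDerivAt (fun t : ℝ => A * (((1 + k) * t ^ (1 + k) - (1 - k) * (σ ^ 2 * t ^ (1 - k))) *
          (σ ^ 2 * t ^ (1 - k) + t ^ (1 + k)) -
        (m + 1) * (t ^ (1 + k) - σ ^ 2 * t ^ (1 - k)) *
          ((1 + k) * t ^ (1 + k) + (1 - k) * (σ ^ 2 * t ^ (1 - k)))) *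
        (σ ^ 2 * t ^ (1 - k) + t ^ (1 + k)) ^ (-(m + 2)) / t)
      (-(2 * m + 1) / r * (A * (((1 + k) * r ^ (1 + k) - (1 - k) * (σ ^ 2 * r ^ (1 - k))) *
          (σ ^ 2 * r ^ (1 - k) + r ^ (1 + k)) -
        (m + 1) * (r ^ (1 + k) - σ ^ 2 * r ^ (1 - k)) *
          ((1 + k) * r ^ (1 + k) + (1 - k) * (σ ^ 2 * r ^ (1 - k)))) *
        (σ ^ 2 * r ^ (1 - k) + r ^ (1 + k)) ^ (-(m + 2)) / r) -
        (m ^ 2 * (1 - k ^ 2) / r ^ 2 + 4 * (m + 1) * (m + 2) * k ^ 2 * σ ^ 2 /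
          (σ ^ 2 * r ^ (1 - k) + r ^ (1 + k)) ^ 2) *
        (A * (r ^ (1 + k) - σ ^ 2 * r ^ (1 - k)) *
          (σ ^ 2 * r ^ (1 - k) + r ^ (1 + k)) ^ (-(m + 1)))) r := by
  have hD : 0 < σ ^ 2 * r ^ (1 - k) + r ^ (1 + k) := by positivity
  have ha := hasDerivAt_rpow_euler (1 + k) hr
  have hb := (hasDerivAt_rpow_euler (1 - k) hr).const_mul (σ ^ 2)
  have h := ((((((ha.const_mul (1 + k)).sub (hb.const_mul (1 - k))).mul (hb.add ha)).sub
    (((ha.sub hb).const_mul (m + 1)).mul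
      ((ha.const_mul (1 + k)).add (hb.const_mul (1 - k))))).const_mul A).mul
    (hasDerivAt_denominator_rpow (k := k) (-(m + 2)) hσ hr)).div (hasDerivAt_id r) hr.ne'
  refine h.congr_deriv ?_
  have hab : r ^ (1 + k) * r ^ (1 - k) = r ^ 2 := by
    rw [← Real.rpow_add hr, ← Real.rpow_natCast]
    norm_num
  have e₂ : (σ ^ 2 * r ^ (1 - k) + r ^ (1 + k)) ^ (-(m + 2)) =
      (σ ^ 2 * r ^ (1 - k) + r ^ (1 + k)) ^ (-(m + 3)) *
        (σ ^ 2 * r ^ (1 - k) + r ^ (1 + k)) := by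
    rw [← Real.rpow_add_one hD.ne']
    ring_nf
  have e₁ : (σ ^ 2 * r ^ (1 - k) + r ^ (1 + k)) ^ (-(m + 1)) =
      (σ ^ 2 * r ^ (1 - k) + r ^ (1 + k)) ^ (-(m + 3)) *
        (σ ^ 2 * r ^ (1 - k) + r ^ (1 + k)) ^ 2 := by
    rw [← Real.rpow_natCast (σ ^ 2 * r ^ (1 - k) + r ^ (1 + k)) 2, ← Real.rpow_add hD]
    congr 1
    push_cast
    ring
  have e₃ : 4 * (m + 1) * (m + 2) * k ^ 2 * σ ^ 2 =
      4 * (m + 1) * (m + 2) * k ^ 2 * (σ ^ 2 * (r ^ (1 + k) * r ^ (1 - k))) / r ^ 2 := by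
    rw [hab]
    field_simp
  simp only [Pi.sub_apply, Pi.add_apply, Pi.mul_apply, id]
  rw [show -(m + 2) - 1 = -(m + 3) by ring, e₁, e₂, e₃]
  generalize (σ ^ 2 * r ^ (1 - k) + r ^ (1 + k)) ^ (-(m + 3)) = X
  generalize r ^ (1 + k) = a at *
  generalize r ^ (1 - k) = b at *
  field_simp
  ring

end Profile


/-- `W_σ = ∂V_σ/∂σ` is an eigenfunction of the linearized operator
`−Δ − μ/|x|²` with weight `V_σ^{2*−2}` and eigenvalue `2* − 1` on `ℝ^N \ {0}`. -/
theorem hardy_bubble_derivative_eigenfunction (N : ℕ) (hN : 3 ≤ N) (μ σ : ℝ)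
    (hμ : 0 < μ) (hμ' : μ < ((N : ℝ) - 2) ^ 2 / 4) (hσ : 0 < σ)
    (β₁ β₂ Cμ : ℝ)
    (hβ₁ : β₁ = (Real.sqrt (((N : ℝ) - 2) ^ 2 / 4) -
        Real.sqrt (((N : ℝ) - 2) ^ 2 / 4 - μ)) / Real.sqrt (((N : ℝ) - 2) ^ 2 / 4))
    (hβ₂ : β₂ = (Real.sqrt (((N : ℝ) - 2) ^ 2 / 4) +
        Real.sqrt (((N : ℝ) - 2) ^ 2 / 4 - μ)) / Real.sqrt (((N : ℝ) - 2) ^ 2 / 4))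
    (hC : Cμ = (4 * (N : ℝ) * (((N : ℝ) - 2) ^ 2 / 4 - μ) / ((N : ℝ) - 2)) ^ (((N : ℝ) - 2) / 4))
    (V W : EuclideanSpace ℝ (Fin N) → ℝ)
    (hV : ∀ x, V x = Cμ * (σ / (σ ^ 2 * ‖x‖ ^ β₁ + ‖x‖ ^ β₂)) ^ (((N : ℝ) - 2) / 2))
    (hW : ∀ x, W x = Cμ * (((N : ℝ) - 2) / 2) * σ ^ (((N : ℝ) - 4) / 2) *
        (‖x‖ ^ β₂ - σ ^ 2 * ‖x‖ ^ β₁) /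
        (σ ^ 2 * ‖x‖ ^ β₁ + ‖x‖ ^ β₂) ^ ((N : ℝ) / 2)) :
    ∀ x : EuclideanSpace ℝ (Fin N), x ≠ 0 →
      -(∑ i : Fin N,
          fderiv ℝ (fun y => fderiv ℝ W y (EuclideanSpace.single i (1 : ℝ))) x
            (EuclideanSpace.single i (1 : ℝ))) -
        μ * W x / ‖x‖ ^ 2 =
        (2 * (N : ℝ) / ((N : ℝ) - 2) - 1) *
          V x ^ (2 * (N : ℝ) / ((N : ℝ) - 2) - 2) * W x := by
  intro x hx
  have hN' : (3 : ℝ) ≤ N := by exact_mod_cast hN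
  obtain ⟨m, hm⟩ : ∃ m : ℝ, m = ((N : ℝ) - 2) / 2 := ⟨_, rfl⟩
  have hm0 : 0 < m := by rw [hm]; linarith
  have hNm : (N : ℝ) = 2 * m + 2 := by rw [hm]; ring
  obtain ⟨k, hk⟩ : ∃ k : ℝ, k = Real.sqrt (m ^ 2 - μ) / m := ⟨_, rfl⟩
  have hbar : ((N : ℝ) - 2) ^ 2 / 4 = m ^ 2 := by rw [hm]; ring
  rw [hbar] at hμ' hβ₁ hβ₂ hC
  rw [Real.sqrt_sq hm0.le] at hβ₁ hβ₂
  have hβ₁' : β₁ = 1 - k := by rw [hβ₁, hk]; field_simp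
  have hβ₂' : β₂ = 1 + k := by rw [hβ₂, hk]; field_simp
  have hμk : m ^ 2 - μ = m ^ 2 * k ^ 2 := by
    rw [hk, div_pow, Real.sq_sqrt (by linarith)]
    field_simp
  have hμk' : μ = m ^ 2 * (1 - k ^ 2) := by linarith
  have hk2 : 0 < k ^ 2 := by
    have : 0 < m ^ 2 * k ^ 2 := by linarith
    exact pos_of_mul_pos_right this (sq_nonneg m)
  have hr : 0 < ‖x‖ := norm_pos_iff.mpr hx
  have hD : ∀ y : EuclideanSpace ℝ (Fin N), 0 ≤ σ ^ 2 * ‖y‖ ^ (1 - k) + ‖y‖ ^ (1 + k) :=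
    fun y => by positivity
  have hDx : 0 < σ ^ 2 * ‖x‖ ^ (1 - k) + ‖x‖ ^ (1 + k) := by positivity
  obtain ⟨A, hA⟩ : ∃ A : ℝ, A = Cμ * m * σ ^ (((N : ℝ) - 4) / 2) := ⟨_, rfl⟩
  have hWf : W = fun y => (fun t : ℝ => A * (t ^ (1 + k) - σ ^ 2 * t ^ (1 - k)) *
        (σ ^ 2 * t ^ (1 - k) + t ^ (1 + k)) ^ (-(m + 1))) ‖y‖ := by
    funext y
    beta_reduce
    rw [hW y, hβ₁', hβ₂', ← hm, ← hA, Real.rpow_neg (hD y), div_eq_mul_inv,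
      show (N : ℝ) / 2 = m + 1 by rw [hNm]; ring]
  have hCpos : 0 < 4 * (m + 1) * m * k ^ 2 := by positivity
  have hC' : Cμ = (4 * (m + 1) * m * k ^ 2) ^ (m / 2) := by
    rw [hC, hμk, hNm, add_sub_cancel_right]
    congr 1
    · field_simp
    · field_simp
      ring
  have hVx : V x ^ (2 * (N : ℝ) / ((N : ℝ) - 2) - 2) =
      4 * (m + 1) * m * k ^ 2 * σ ^ 2 / (σ ^ 2 * ‖x‖ ^ (1 - k) + ‖x‖ ^ (1 + k)) ^ 2 := by
    rw [hV x, hβ₁', hβ₂', ← hm, hC', hNm, Real.mul_rpow (by positivity) (by positivity),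
      ← Real.rpow_mul hCpos.le, ← Real.rpow_mul (by positivity)]
    have h1 : m / 2 * (2 * (2 * m + 2) / (2 * m + 2 - 2) - 2) = 1 := by
      rw [show 2 * m + 2 - 2 = 2 * m by ring]
      field_simp
      ring
    have h2 : m * (2 * (2 * m + 2) / (2 * m + 2 - 2) - 2) = (2 : ℕ) := by
      push_cast
      linarith
    rw [h1, h2, Real.rpow_one, Real.rpow_natCast, div_pow, mul_div_assoc]
  rw [hVx, hWf, sum_fderiv_fderiv_comp_norm hx (fun r hr => hasDerivAt_profile hσ hr)
    (hasDerivAt_deriv_profile hσ hr), hNm, hμk', show 2 * m + 2 - 2 = 2 * m by ring]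
  beta_reduce
  generalize (σ ^ 2 * ‖x‖ ^ (1 - k) + ‖x‖ ^ (1 + k)) ^ (-(m + 2)) = Y
  generalize (σ ^ 2 * ‖x‖ ^ (1 - k) + ‖x‖ ^ (1 + k)) ^ (-(m + 1)) = X
  generalize σ ^ 2 * ‖x‖ ^ (1 - k) + ‖x‖ ^ (1 + k) = D at *
  field_simp
  ring
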